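/- Suppose that for every θ ∈ Θ_f there is exactly one pair (λ, μ) ∈ ℝ^{m₁} × ℝ^{m₂} such that (x*(θ), λ, μ) satisfies the KKT conditions for QP(θ), and let μ* : Θ_f → ℝ^{m₂} assign to each θ this unique inequality multiplier μ. Then μ* is piecewise linear: there exist K ∈ ℕ, convex sets R₁, …, R_K ⊆ ℝ^{m₁} with Θ_f = R₁ ∪ ⋯ ∪ R_K, matrices N₁, …, N_K ∈ ℝ^{m₂×m₁} and vectors e₁, …, e_K ∈ ℝ^{m₂} such that for every j and every θ ∈ R_j, μ*(θ) = N_j θ + e_j. -/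

import Mathlib

open Matrix

/-- The KKT conditions for `QP(θ)`: stationarity, primal feasibility,
dual feasibility, and complementary slackness. -/
def IsKKT {n m₁ m₂ : ℕ}
    (Q : Matrix (Fin n) (Fin n) ℝ) (C : Fin n → ℝ)
    (Ae : Matrix (Fin m₁) (Fin n) ℝ) (be : Fin m₁ → ℝ)
    (AC : Matrix (Fin m₂) (Fin n) ℝ) (bC : Fin m₂ → ℝ)
    (θ : Fin m₁ → ℝ)
    (x : Fin n → ℝ) (lam : Fin m₁ → ℝ) (μ : Fin m₂ → ℝ) : Prop :=
  (2 : ℝ) • Q.mulVec x + C + Ae.transpose.mulVec lam + AC.transpose.mulVec μ = 0 ∧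
  Ae.mulVec x = be + θ ∧
  AC.mulVec x ≤ bC ∧
  0 ≤ μ ∧
  ∀ i, μ i * (AC.mulVec x - bC) i = 0

/-- A convex subset of a product that is the graph of a function over its first projection
lies in the graph of an affine map. -/
theorem Convex.exists_linearMap_add_of_graph {E F : Type*} [AddCommGroup E] [Module ℝ E]
    [AddCommGroup F] [Module ℝ F] {S : Set (E × F)} (hS : Convex ℝ S)
    (hinj : ∀ p ∈ S, ∀ q ∈ S, p.1 = q.1 → p.2 = q.2) :
    ∃ (L : E →ₗ[ℝ] F) (c : F), ∀ p ∈ S, p.2 = L p.1 + c := by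
  rcases S.eq_empty_or_nonempty with rfl | ⟨s₀, hs₀⟩
  · exact ⟨0, 0, by simp⟩
  set D : Submodule ℝ (E × F) := Submodule.span ℝ {d | ∃ p ∈ S, ∃ q ∈ S, d = p - q} with hD
  have hrep : ∀ d ∈ D, ∃ t : ℝ, 0 < t ∧ ∃ p ∈ S, ∃ q ∈ S, d = t • (p - q) := by
    intro d hd
    induction hd using Submodule.span_induction with
    | mem d hd =>
      obtain ⟨p, hp, q, hq, rfl⟩ := hd
      exact ⟨1, one_pos, p, hp, q, hq, by simp⟩
    | zero => exact ⟨1, one_pos, s₀, hs₀, s₀, hs₀, by simp⟩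
    | add d d' _ _ h h' =>
      obtain ⟨t, ht, p, hp, q, hq, rfl⟩ := h
      obtain ⟨u, hu, p', hp', q', hq', rfl⟩ := h'
      have htu : t + u ≠ 0 := by positivity
      have hsum : t / (t + u) + u / (t + u) = 1 := by field_simp
      refine ⟨t + u, by positivity,
        (t / (t + u)) • p + (u / (t + u)) • p', hS hp hp' (by positivity) (by positivity) hsum,
        (t / (t + u)) • q + (u / (t + u)) • q', hS hq hq' (by positivity) (by positivity) hsum, ?_⟩
      simp only [smul_sub, smul_add, smul_smul, mul_div_cancel₀ _ htu]
      abel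
    | smul a d _ h =>
      obtain ⟨t, ht, p, hp, q, hq, rfl⟩ := h
      rcases lt_trichotomy a 0 with ha | rfl | ha
      · refine ⟨-a * t, by nlinarith, q, hq, p, hp, ?_⟩
        rw [smul_smul, ← neg_sub p q, smul_neg, neg_mul, neg_smul, neg_neg]
      · exact ⟨1, one_pos, s₀, hs₀, s₀, hs₀, by simp⟩
      · exact ⟨a * t, by positivity, p, hp, q, hq, by rw [smul_smul]⟩
  have hker : LinearMap.ker (LinearMap.fst ℝ E F ∘ₗ D.subtype) = ⊥ := by
    rw [LinearMap.ker_eq_bot']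
    rintro ⟨d, hd⟩ h
    obtain ⟨t, ht, p, hp, q, hq, rfl⟩ := hrep d hd
    have h1 : p.1 = q.1 := by
      have h2 : t • (p.1 - q.1) = 0 := h
      exact sub_eq_zero.1 ((smul_eq_zero.1 h2).resolve_left ht.ne')
    have hpq : p = q := Prod.ext h1 (hinj p hp q hq h1)
    simp [hpq]
  obtain ⟨g, hg⟩ := LinearMap.exists_leftInverse_of_injective _ hker
  refine ⟨LinearMap.snd ℝ E F ∘ₗ D.subtype ∘ₗ g,
    s₀.2 - (LinearMap.snd ℝ E F ∘ₗ D.subtype ∘ₗ g) s₀.1, fun p hp => ?_⟩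
  have hd : p - s₀ ∈ D := Submodule.subset_span ⟨p, hp, s₀, hs₀, rfl⟩
  have h := congrArg (fun z : D => (z : E × F).2) (LinearMap.congr_fun hg ⟨p - s₀, hd⟩)
  have h' : (LinearMap.snd ℝ E F ∘ₗ D.subtype ∘ₗ g) (p.1 - s₀.1) = p.2 - s₀.2 := h
  rw [map_sub] at h'
  rw [add_sub_left_comm, h']
  abel

section KKT

variable {n m₁ m₂ : ℕ} {Q : Matrix (Fin n) (Fin n) ℝ} {C : Fin n → ℝ}
  {Ae : Matrix (Fin m₁) (Fin n) ℝ} {be : Fin m₁ → ℝ}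
  {AC : Matrix (Fin m₂) (Fin n) ℝ} {bC : Fin m₂ → ℝ}

/-- A KKT point is the only feasible point whose objective value is at most its own. -/
theorem IsKKT.eq_of_le (hQ : Q.PosDef) {θ : Fin m₁ → ℝ} {x y : Fin n → ℝ} {lam : Fin m₁ → ℝ}
    {μ : Fin m₂ → ℝ} (h : IsKKT Q C Ae be AC bC θ x lam μ)
    (hye : Ae.mulVec y = be + θ) (hyC : AC.mulVec y ≤ bC)
    (hle : y ⬝ᵥ Q.mulVec y + C ⬝ᵥ y ≤ x ⬝ᵥ Q.mulVec x + C ⬝ᵥ x) : y = x := by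
  obtain ⟨hstat, hxe, -, hμ, hcomp⟩ := h
  obtain ⟨d, rfl⟩ : ∃ d, y = x + d := ⟨y - x, by simp⟩
  have hed : Ae.mulVec d = 0 := by
    rw [mulVec_add, hxe] at hye
    simpa using hye
  have hCd : μ ⬝ᵥ AC.mulVec d ≤ 0 := by
    refine Finset.sum_nonpos fun i _ => ?_
    have h1 := hyC i
    have h2 := hcomp i
    have h3 := hμ i
    simp only [mulVec_add, Pi.add_apply, Pi.sub_apply, Pi.zero_apply] at h1 h2 h3
    nlinarith
  have hsymm : d ⬝ᵥ Q.mulVec x = x ⬝ᵥ Q.mulVec d := by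
    have hT : Qᵀ = Q := by simpa using hQ.isHermitian.eq
    rw [dotProduct_mulVec, ← mulVec_transpose, hT, dotProduct_comm]
  have hgrad : 2 * (x ⬝ᵥ Q.mulVec d) + C ⬝ᵥ d + μ ⬝ᵥ AC.mulVec d = 0 := by
    have h1 := congrArg (fun v => d ⬝ᵥ v) hstat
    simp only [dotProduct_add, dotProduct_smul, dotProduct_zero, smul_eq_mul, hsymm,
      mulVec_transpose] at h1
    rw [dotProduct_comm d (lam ᵥ* Ae), dotProduct_comm d (μ ᵥ* AC), ← dotProduct_mulVec,
      ← dotProduct_mulVec, hed, dotProduct_zero, dotProduct_comm d C] at h1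
    linarith
  by_contra hne
  have hd : d ≠ 0 := by
    rintro rfl
    simp at hne
  have hpos : 0 < d ⬝ᵥ Q.mulVec d := by simpa using hQ.dotProduct_mulVec_pos hd
  simp only [mulVec_add, dotProduct_add, add_dotProduct, hsymm] at hle
  linarith

/-- Pairs of a parameter and an inequality multiplier coming from a KKT point at which the
constraints in `J` are active and the multipliers outside `J` vanish. -/
def kktActiveGraph (Q : Matrix (Fin n) (Fin n) ℝ) (C : Fin n → ℝ)
    (Ae : Matrix (Fin m₁) (Fin n) ℝ) (be : Fin m₁ → ℝ)
    (AC : Matrix (Fin m₂) (Fin n) ℝ) (bC : Fin m₂ → ℝ) (J : Finset (Fin m₂)) :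
    Set ((Fin m₁ → ℝ) × (Fin m₂ → ℝ)) :=
  {p | ∃ x lam, IsKKT Q C Ae be AC bC p.1 x lam p.2 ∧
    (∀ i ∈ J, AC.mulVec x i = bC i) ∧ ∀ i ∉ J, p.2 i = 0}

theorem convex_kktActiveGraph (J : Finset (Fin m₂)) :
    Convex ℝ (kktActiveGraph Q C Ae be AC bC J) := by
  rintro ⟨θ, μ⟩ ⟨x, lam, ⟨hs, he, hC, hμ, -⟩, hJ, hJ'⟩
    ⟨θ', μ'⟩ ⟨x', lam', ⟨hs', he', hC', hμ', -⟩, hK, hK'⟩ a b ha hb hab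
  dsimp only at hs he hC hμ hJ' hs' he' hC' hμ' hK'
  have hact : ∀ i ∈ J, AC.mulVec (a • x + b • x') i = bC i := by
    intro i hi
    simp only [mulVec_add, mulVec_smul, Pi.add_apply, Pi.smul_apply, smul_eq_mul, hJ i hi, hK i hi]
    rw [← add_mul, hab, one_mul]
  have hvan : ∀ i ∉ J, (a • μ + b • μ') i = 0 := by
    intro i hi
    simp [hJ' i hi, hK' i hi]
  refine ⟨a • x + b • x', a • lam + b • lam', ⟨?_, ?_, ?_, ?_, ?_⟩, hact, hvan⟩
  · have hb' : b = 1 - a := by linarith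
    subst hb'
    ext i
    have h1 := congrFun hs i
    have h2 := congrFun hs' i
    simp only [Prod.smul_mk, Prod.mk_add_mk, mulVec_add, mulVec_smul,
      Pi.add_apply, Pi.smul_apply, smul_eq_mul, Pi.zero_apply] at h1 h2 ⊢
    linear_combination a * h1 + (1 - a) * h2
  · have hb' : b = 1 - a := by linarith
    subst hb'
    ext i
    have h1 := congrFun he i
    have h2 := congrFun he' i
    simp only [Prod.smul_mk, Prod.mk_add_mk, mulVec_add, mulVec_smul,
      Pi.add_apply, Pi.smul_apply, smul_eq_mul] at h1 h2 ⊢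
    linear_combination a * h1 + (1 - a) * h2
  · rw [mulVec_add, mulVec_smul, mulVec_smul]
    exact convex_Iic bC hC hC' ha hb hab
  · exact convex_Ici (0 : Fin m₂ → ℝ) hμ hμ' ha hb hab
  · intro i
    by_cases hi : i ∈ J
    · rw [Pi.sub_apply, hact i hi, sub_self, mul_zero]
    · exact mul_eq_zero_of_left (hvan i hi) _

/-- Every KKT point has its parameter and multiplier in the graph of its active set. -/
theorem IsKKT.mem_kktActiveGraph {θ : Fin m₁ → ℝ} {x : Fin n → ℝ} {lam : Fin m₁ → ℝ}
    {μ : Fin m₂ → ℝ} (h : IsKKT Q C Ae be AC bC θ x lam μ) :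
    (θ, μ) ∈ kktActiveGraph Q C Ae be AC bC {i | AC.mulVec x i = bC i} := by
  refine ⟨x, lam, h, fun i hi => by simpa using hi, fun i hi => ?_⟩
  have hi' : (AC.mulVec x - bC) i ≠ 0 := by simpa [sub_eq_zero] using hi
  exact (mul_eq_zero.1 (h.2.2.2.2 i)).resolve_right hi'

end KKT

/-- If for every feasible `θ` the KKT multipliers at the optimizer `x*(θ)`
are unique, then the inequality-multiplier (shadow price) map `μ*` is
piecewise linear on the feasible parameter set. -/
theorem shadow_price_map_piecewise_linear
    (n m₁ m₂ : ℕ)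
    (Q : Matrix (Fin n) (Fin n) ℝ) (hQ : Q.PosDef)
    (C : Fin n → ℝ)
    (Ae : Matrix (Fin m₁) (Fin n) ℝ) (be : Fin m₁ → ℝ)
    (AC : Matrix (Fin m₂) (Fin n) ℝ) (bC : Fin m₂ → ℝ)
    (X : (Fin m₁ → ℝ) → Set (Fin n → ℝ))
    (hX : ∀ θ, X θ = {x : Fin n → ℝ | Ae.mulVec x = be + θ ∧ AC.mulVec x ≤ bC})
    (f : (Fin n → ℝ) → ℝ)
    (hf : ∀ x, f x = x ⬝ᵥ Q.mulVec x + C ⬝ᵥ x)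
    (Θf : Set (Fin m₁ → ℝ)) (hΘf : Θf = {θ : Fin m₁ → ℝ | (X θ).Nonempty})
    (xstar : (Fin m₁ → ℝ) → (Fin n → ℝ))
    (hxstar : ∀ θ ∈ Θf, xstar θ ∈ X θ ∧ ∀ y ∈ X θ, f (xstar θ) ≤ f y)
    (huniq : ∀ θ ∈ Θf, ∃! p : (Fin m₁ → ℝ) × (Fin m₂ → ℝ),
      IsKKT Q C Ae be AC bC θ (xstar θ) p.1 p.2)
    (mustar : (Fin m₁ → ℝ) → (Fin m₂ → ℝ))
    (hmustar : ∀ θ ∈ Θf, ∃ lam : Fin m₁ → ℝ,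
      IsKKT Q C Ae be AC bC θ (xstar θ) lam (mustar θ)) :
    ∃ (K : ℕ) (R : Fin K → Set (Fin m₁ → ℝ))
      (N : Fin K → Matrix (Fin m₂) (Fin m₁) ℝ) (e : Fin K → (Fin m₂ → ℝ)),
      (∀ j, Convex ℝ (R j)) ∧
      Θf = ⋃ j, R j ∧
      ∀ j, ∀ θ ∈ R j, mustar θ = (N j).mulVec θ + e j := by
  have hfeas : ∀ {θ x lam μ}, IsKKT Q C Ae be AC bC θ x lam μ → θ ∈ Θf := by
    intro θ x lam μ h
    rw [hΘf]
    exact ⟨x, by rw [hX]; exact ⟨h.2.1, h.2.2.1⟩⟩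
  have hmu : ∀ {θ x lam μ}, IsKKT Q C Ae be AC bC θ x lam μ → μ = mustar θ := by
    intro θ x lam μ h
    have hθ := hfeas h
    obtain ⟨hmem, hmin⟩ := hxstar θ hθ
    have hle := hmin x (by rw [hX]; exact ⟨h.2.1, h.2.2.1⟩)
    rw [hf, hf] at hle
    rw [hX] at hmem
    obtain rfl := h.eq_of_le hQ hmem.1 hmem.2 hle
    obtain ⟨lam', h'⟩ := hmustar θ hθ
    exact congrArg Prod.snd ((huniq θ hθ).unique (y₁ := (lam, μ)) (y₂ := (lam', mustar θ)) h h')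
  have haff : ∀ J, ∃ (L : (Fin m₁ → ℝ) →ₗ[ℝ] (Fin m₂ → ℝ)) (c : Fin m₂ → ℝ),
      ∀ p ∈ kktActiveGraph Q C Ae be AC bC J, p.2 = L p.1 + c := by
    refine fun J => (convex_kktActiveGraph J).exists_linearMap_add_of_graph ?_
    rintro p ⟨x, lam, hp, -⟩ q ⟨y, lam', hq, -⟩ hpq
    rw [hmu hp, hmu hq, hpq]
  choose L c hL using haff
  let idx := (Fintype.equivFin (Finset (Fin m₂))).symm
  refine ⟨Fintype.card (Finset (Fin m₂)),
    fun j => Prod.fst '' kktActiveGraph Q C Ae be AC bC (idx j),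
    fun j => LinearMap.toMatrix' (L (idx j)), fun j => c (idx j), fun j => ?_, ?_, ?_⟩
  · exact (convex_kktActiveGraph (idx j)).linear_image (LinearMap.fst ℝ _ _)
  · refine Set.Subset.antisymm (fun θ hθ => ?_) (Set.iUnion_subset fun j => ?_)
    · obtain ⟨lam, h⟩ := hmustar θ hθ
      refine Set.mem_iUnion.2 ⟨idx.symm {i | AC.mulVec (xstar θ) i = bC i}, (θ, mustar θ), ?_, rfl⟩
      rw [idx.apply_symm_apply]
      exact h.mem_kktActiveGraph
    · rintro _ ⟨p, ⟨x, lam, h, -⟩, rfl⟩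
      exact hfeas h
  · rintro j _ ⟨p, hp, rfl⟩
    obtain ⟨x, lam, h, -⟩ := id hp
    rw [LinearMap.toMatrix'_mulVec, ← hL _ p hp, hmu h]
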